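/- arXiv:1306.1957 — 2 statements merged into one kernel-verified Lean document; each statement's English description precedes it below -/
import Mathlib

section
/- In any AND(1)-realization of a cycle C_n with distinct representative points, the two extreme vertices (those whose representatives are smallest and largest) are adjacent in C_n. -/
/-- An `AND(1)`-realization of `G`: each vertex `v` gets a closed interval
`[L v, R v]` and a representative point `p v` in it, with adjacency of distinct
vertices iff mutual containment of the representative points. -/
def IsAND1Real {V : Type*} (G : SimpleGraph V) (L R p : V → ℝ) : Prop :=
  (∀ v, L v ≤ p v ∧ p v ≤ R v) ∧
    ∀ u v : V, u ≠ v →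
      (G.Adj u v ↔ L u ≤ p v ∧ p v ≤ R u ∧ L v ≤ p u ∧ p u ≤ R v)

/-- A central (`c`-)`AND(1)`-realization: moreover each representative point is
the midpoint of its interval. -/
def IsCAND1Real {V : Type*} (G : SimpleGraph V) (L R p : V → ℝ) : Prop :=
  IsAND1Real G L R p ∧ ∀ v, p v = (L v + R v) / 2

/-- The class `AND(1)`. -/
def InAND1 {V : Type*} (G : SimpleGraph V) : Prop :=
  ∃ L R p : V → ℝ, IsAND1Real G L R p

/-- The class `c-AND(1)`. -/
def InCAND1 {V : Type*} (G : SimpleGraph V) : Prop :=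
  ∃ L R p : V → ℝ, IsCAND1Real G L R p

/-- A linear ordering of the vertices (an injective map to `ℝ`) satisfying the
four point condition: `x < u < v < y` with `xv, uy ∈ E` implies `uv ∈ E`. -/
def FourPointCond {V : Type*} (G : SimpleGraph V) (f : V → ℝ) : Prop :=
  Function.Injective f ∧
    ∀ x u v y : V, f x < f u → f u < f v → f v < f y →
      G.Adj x v → G.Adj u y → G.Adj u v

/-- Two adjacent pairs `a b` and `c d` with `p a ≤ p c < p b ≤ p d` force `c` and `b` to be
adjacent. -/
theorem IsAND1Real.adj_of_cross {V : Type*} {G : SimpleGraph V} {L R p : V → ℝ}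
    (h : IsAND1Real G L R p) {a b c d : V} (hab : G.Adj a b) (hcd : G.Adj c d)
    (hac : p a ≤ p c) (hcb : p c < p b) (hbd : p b ≤ p d) : G.Adj c b := by
  have hne : c ≠ b := fun e => hcb.ne (congrArg p e)
  have h₁ := (h.2 a b hab.ne).1 hab
  have h₂ := (h.2 c d hcd.ne).1 hcd
  exact (h.2 c b hne).2 ⟨(h.1 c).1.trans hcb.le, hbd.trans h₂.2.1, h₁.2.2.1.trans hac,
    hcb.le.trans (h.1 b).2⟩

open Fin.CommRing in
/-- Let `u` be leftmost, `v` rightmost and `s = ±1`. If `v` is neither `u` nor its neighbour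
`u - s`, then the other neighbour `u + s` of `u` does not lie to the left of `u - s`. -/
theorem IsAND1Real.not_lt_of_cycleGraph {k : ℕ} {L R p : Fin (k + 3) → ℝ}
    (hreal : IsAND1Real (SimpleGraph.cycleGraph (k + 3)) L R p)
    {u v s : Fin (k + 3)} (hs : s = 1 ∨ s = -1)
    (hu : ∀ w, p u ≤ p w) (hv : ∀ w, p w ≤ p v) (hvu : v ≠ u) (hvb : v ≠ u - s) :
    ¬ p (u + s) < p (u - s) := by
  intro hlt
  have hss : s * s = 1 := by rcases hs with rfl | rfl <;> ring
  have cast_eq_zero : ∀ i : ℕ, (i : Fin (k + 3)) = 0 ↔ k + 3 ∣ i := fun i =>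
    Fin.natCast_eq_zero
  obtain ⟨m, hm1, hmk, hmv⟩ : ∃ m : ℕ, 1 ≤ m ∧ m ≤ k + 1 ∧ u + s * m = v := by
    have hval : u + s * ((s * (v - u)).val : Fin (k + 3)) = v := by
      rw [Fin.cast_val_eq_self]
      linear_combination (v - u) * hss
    have hbound := (s * (v - u)).isLt
    generalize (s * (v - u)).val = m at hval hbound
    refine ⟨m, ?_, ?_, hval⟩
    · by_contra hc
      obtain rfl : m = 0 := by omega
      exact hvu (by simpa using hval.symm)
    · by_contra hc
      obtain rfl : m = k + 2 := by omega
      have h3 : ((k + 3 : ℕ) : Fin (k + 3)) = 0 := (cast_eq_zero _).2 dvd_rfl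
      push_cast at h3 hval
      exact hvb (by linear_combination s * h3 - hval)
  have left_of_b : ∀ i : ℕ, 1 ≤ i → i ≤ k + 1 → p (u + s * i) < p (u - s) := by
    intro i hi
    induction i, hi using Nat.le_induction with
    | base => intro _; simpa using hlt
    | succ i hi ih =>
      intro hik
      by_contra! hbd
      have hub : (SimpleGraph.cycleGraph (k + 3)).Adj u (u - s) := by
        rw [SimpleGraph.cycleGraph_adj]
        rcases hs with rfl | rfl
        · left; ring
        · right; ring
      have hcd : (SimpleGraph.cycleGraph (k + 3)).Adj (u + s * i) (u + s * (i + 1 : ℕ)) := by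
        rw [SimpleGraph.cycleGraph_adj]
        push_cast
        rcases hs with rfl | rfl
        · right; ring
        · left; ring
      have hcb := hreal.adj_of_cross hub hcd (hu _) (ih (by omega)) hbd
      have hdiff : (i : Fin (k + 3)) + 1 = 1 ∨ (i : Fin (k + 3)) + 1 = -1 := by
        rw [SimpleGraph.cycleGraph_adj] at hcb
        rcases hs with rfl | rfl <;> rcases hcb with e | e
        · left; linear_combination e
        · right; linear_combination -e
        · right; linear_combination -e
        · left; linear_combination e
      rcases hdiff with e | e
      · have := Nat.le_of_dvd (by omega) ((cast_eq_zero i).1 (by linear_combination e))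
        omega
      · have := Nat.le_of_dvd (by omega)
          ((cast_eq_zero (i + 2)).1 (by push_cast; linear_combination e))
        omega
  have := left_of_b m hm1 hmk
  rw [hmv] at this
  exact (hv _).not_gt this

/-- In any `AND(1)`-realization of the cycle `Cₙ` (`n ≥ 3`) with distinct
representative points, the two extreme vertices (those whose representative
points are smallest and largest) are adjacent in `Cₙ`. -/
theorem cycle_extremes_adjacent (n : ℕ) (hn : 3 ≤ n) (L R p : Fin n → ℝ)
    (hreal : IsAND1Real (SimpleGraph.cycleGraph n) L R p)
    (hp : Function.Injective p) (u v : Fin n)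
    (hu : ∀ w, p u ≤ p w) (hv : ∀ w, p w ≤ p v) :
    (SimpleGraph.cycleGraph n).Adj u v := by
  obtain ⟨k, rfl⟩ := Nat.exists_eq_add_of_le' hn
  by_contra hadj
  open Fin.CommRing in
  · rw [SimpleGraph.cycleGraph_adj, not_or] at hadj
    have hvu : v ≠ u := by
      rintro rfl
      have : v = v + 1 := hp (le_antisymm (hu _) (hv _))
      simp at this
    have hpred : v ≠ u - 1 := fun e => hadj.1 (by rw [e]; ring)
    have hsucc : v ≠ u - -1 := fun e => hadj.2 (by rw [e]; ring)
    have h₁ := hreal.not_lt_of_cycleGraph (.inl rfl) hu hv hvu hpred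
    have h₂ := hreal.not_lt_of_cycleGraph (.inr rfl) hu hv hvu hsucc
    rw [sub_neg_eq_add, ← sub_eq_add_neg] at h₂
    have heq : u + 1 = u - 1 := hp (le_antisymm (not_lt.1 h₂) (not_lt.1 h₁))
    have h2 : ((2 : ℕ) : Fin (k + 3)) = 0 := by
      push_cast
      linear_combination heq
    have := Nat.le_of_dvd (by omega) (Fin.natCast_eq_zero.1 h2)
    omega
end

section
/- For all path lengths l_z ≥ l_y ≥ l_x ≥ 3, the theta graph H^{l_x,l_y,l_z} does not belong to c-AND(1); moreover, for all l_y, l_z ≥ 2 the graph H^{2,l_y,l_z} belongs to AND(1), and for all l_y, l_z ≥ 3 the graph H^{3,l_y,l_z} belongs to AND(1). In particular, the complete bipartite graph K_{2,3} = H^{2,2,2} belongs to AND(1) but not to c-AND(1). -/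
/-- `G` is the theta graph `H^{lx, ly, lz}`: two distinct vertices `a = X 0`
and `b = X (last)` joined by three internally vertex-disjoint paths `X`, `Y`,
`Z` of edge-lengths `lx`, `ly`, `lz`, these being all the vertices and (the
consecutive pairs along the paths) all the edges of `G`. -/
def IsThetaGraph {V : Type*} (G : SimpleGraph V) (lx ly lz : ℕ) : Prop :=
  ∃ (X : Fin (lx + 1) → V) (Y : Fin (ly + 1) → V) (Z : Fin (lz + 1) → V),
    Function.Injective X ∧ Function.Injective Y ∧ Function.Injective Z ∧
    X 0 = Y 0 ∧ Y 0 = Z 0 ∧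
    X (Fin.last lx) = Y (Fin.last ly) ∧ Y (Fin.last ly) = Z (Fin.last lz) ∧
    (∀ i j, X i = Y j → (i = 0 ∧ j = 0) ∨ (i = Fin.last lx ∧ j = Fin.last ly)) ∧
    (∀ i j, X i = Z j → (i = 0 ∧ j = 0) ∨ (i = Fin.last lx ∧ j = Fin.last lz)) ∧
    (∀ i j, Y i = Z j → (i = 0 ∧ j = 0) ∨ (i = Fin.last ly ∧ j = Fin.last lz)) ∧
    (∀ v : V, (∃ i, X i = v) ∨ (∃ i, Y i = v) ∨ (∃ i, Z i = v)) ∧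
    (∀ u v : V, G.Adj u v ↔
      ((∃ i : Fin lx, (X i.castSucc = u ∧ X i.succ = v) ∨
          (X i.castSucc = v ∧ X i.succ = u)) ∨
       (∃ i : Fin ly, (Y i.castSucc = u ∧ Y i.succ = v) ∨
          (Y i.castSucc = v ∧ Y i.succ = u)) ∨
       (∃ i : Fin lz, (Z i.castSucc = u ∧ Z i.succ = v) ∨
          (Z i.castSucc = v ∧ Z i.succ = u))))

/-- The theta graph with its three paths indexed by natural numbers. -/
structure IsThetaOn {V : Type*} (G : SimpleGraph V) (lx ly lz : ℕ) (x y z : ℕ → V) : Prop where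
  injX : ∀ i ≤ lx, ∀ j ≤ lx, x i = x j → i = j
  injY : ∀ i ≤ ly, ∀ j ≤ ly, y i = y j → i = j
  injZ : ∀ i ≤ lz, ∀ j ≤ lz, z i = z j → i = j
  startXY : x 0 = y 0
  startYZ : y 0 = z 0
  endXY : x lx = y ly
  endYZ : y ly = z lz
  disjXY : ∀ i ≤ lx, ∀ j ≤ ly, x i = y j → (i = 0 ∧ j = 0) ∨ (i = lx ∧ j = ly)
  disjXZ : ∀ i ≤ lx, ∀ j ≤ lz, x i = z j → (i = 0 ∧ j = 0) ∨ (i = lx ∧ j = lz)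
  disjYZ : ∀ i ≤ ly, ∀ j ≤ lz, y i = z j → (i = 0 ∧ j = 0) ∨ (i = ly ∧ j = lz)
  cover : ∀ v, (∃ i ≤ lx, x i = v) ∨ (∃ i ≤ ly, y i = v) ∨ (∃ i ≤ lz, z i = v)
  adj_iff : ∀ u v, G.Adj u v ↔
    (∃ i < lx, (x i = u ∧ x (i + 1) = v) ∨ (x i = v ∧ x (i + 1) = u)) ∨
    (∃ i < ly, (y i = u ∧ y (i + 1) = v) ∨ (y i = v ∧ y (i + 1) = u)) ∨
    (∃ i < lz, (z i = u ∧ z (i + 1) = v) ∨ (z i = v ∧ z (i + 1) = u))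

/-- A function on `Fin (l + 1)` extends to the natural numbers. -/
lemma exists_nat_extension {V : Type*} {l : ℕ} (X : Fin (l + 1) → V) :
    ∃ x : ℕ → V, ∀ i (h : i < l + 1), X ⟨i, h⟩ = x i :=
  ⟨fun i => X (Fin.ofNat (l + 1) i), fun i h => by
    congr 1
    ext
    simp [Nat.mod_eq_of_lt h]⟩

lemma IsThetaGraph.exists_isThetaOn {V : Type*} {G : SimpleGraph V} {lx ly lz : ℕ}
    (h : IsThetaGraph G lx ly lz) : ∃ x y z, IsThetaOn G lx ly lz x y z := by
  obtain ⟨X, Y, Z, iX, iY, iZ, sXY, sYZ, eXY, eYZ, dXY, dXZ, dYZ, cov, adj⟩ := h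
  obtain ⟨x, hx⟩ := exists_nat_extension X
  obtain ⟨y, hy⟩ := exists_nat_extension Y
  obtain ⟨z, hz⟩ := exists_nat_extension Z
  rw [show X 0 = x 0 from hx 0 (by omega), show Y 0 = y 0 from hy 0 (by omega)] at sXY
  rw [show Y 0 = y 0 from hy 0 (by omega), show Z 0 = z 0 from hz 0 (by omega)] at sYZ
  rw [show X (Fin.last lx) = x lx from hx lx (by omega),
    show Y (Fin.last ly) = y ly from hy ly (by omega)] at eXY
  rw [show Y (Fin.last ly) = y ly from hy ly (by omega),
    show Z (Fin.last lz) = z lz from hz lz (by omega)] at eYZ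
  simp only [Function.Injective, Fin.forall_iff, Fin.exists_iff, Fin.ext_iff, Fin.castSucc_mk,
    Fin.succ_mk, Fin.val_last, Fin.val_zero, hx, hy, hz] at iX iY iZ dXY dXZ dYZ cov adj
  refine ⟨x, y, z, ?_, ?_, ?_, sXY, sYZ, eXY, eYZ, ?_, ?_, ?_, ?_, ?_⟩
  · exact fun i hi j hj => iX i (by omega) j (by omega)
  · exact fun i hi j hj => iY i (by omega) j (by omega)
  · exact fun i hi j hj => iZ i (by omega) j (by omega)
  · exact fun i hi j hj => dXY i (by omega) j (by omega)
  · exact fun i hi j hj => dXZ i (by omega) j (by omega)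
  · exact fun i hi j hj => dYZ i (by omega) j (by omega)
  · simpa only [exists_prop, Nat.lt_succ_iff] using cov
  · simpa only [exists_prop] using adj

namespace IsThetaOn

variable {V : Type*} {G : SimpleGraph V} {lx ly lz : ℕ} {x y z : ℕ → V}

lemma swap (h : IsThetaOn G lx ly lz x y z) : IsThetaOn G ly lx lz y x z where
  injX := h.injY
  injY := h.injX
  injZ := h.injZ
  startXY := h.startXY.symm
  startYZ := h.startXY.trans h.startYZ
  endXY := h.endXY.symm
  endYZ := h.endXY.trans h.endYZ
  disjXY i hi j hj e := by have := h.disjXY j hj i hi e.symm; tauto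
  disjXZ := h.disjYZ
  disjYZ := h.disjXZ
  cover v := or_left_comm.1 (h.cover v)
  adj_iff u v := (h.adj_iff u v).trans or_left_comm

lemma rotate (h : IsThetaOn G lx ly lz x y z) : IsThetaOn G ly lz lx y z x where
  injX := h.injY
  injY := h.injZ
  injZ := h.injX
  startXY := h.startYZ
  startYZ := (h.startXY.trans h.startYZ).symm
  endXY := h.endYZ
  endYZ := (h.endXY.trans h.endYZ).symm
  disjXY := h.disjYZ
  disjXZ i hi j hj e := by have := h.disjXY j hj i hi e.symm; tauto
  disjYZ i hi j hj e := by have := h.disjXZ j hj i hi e.symm; tauto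
  cover v := or_rotate.1 (h.cover v)
  adj_iff u v := (h.adj_iff u v).trans or_rotate

lemma adjX (h : IsThetaOn G lx ly lz x y z) {i : ℕ} (hi : i < lx) : G.Adj (x i) (x (i + 1)) :=
  (h.adj_iff _ _).2 (Or.inl ⟨i, hi, Or.inl ⟨rfl, rfl⟩⟩)

/-- An inner vertex of a path is adjacent only to its predecessor and its successor. -/
lemma eq_or_eq_of_adj (h : IsThetaOn G lx ly lz x y z) {i : ℕ} (h0 : 0 < i) (hi : i < lx) {w : V}
    (hw : G.Adj (x i) w) : w = x (i - 1) ∨ w = x (i + 1) := by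
  rcases (h.adj_iff _ _).1 hw with
    ⟨j, hj, ⟨e, rfl⟩ | ⟨rfl, e⟩⟩ | ⟨j, hj, ⟨e, rfl⟩ | ⟨rfl, e⟩⟩ | ⟨j, hj, ⟨e, rfl⟩ | ⟨rfl, e⟩⟩
  · obtain rfl := h.injX _ (by omega) _ (by omega) e
    exact Or.inr rfl
  · obtain rfl := h.injX _ (by omega) _ (by omega) e
    exact Or.inl rfl
  · have := h.disjXY i (by omega) j (by omega) e.symm
    omega
  · have := h.disjXY i (by omega) (j + 1) (by omega) e.symm
    omega
  · have := h.disjXZ i (by omega) j (by omega) e.symm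
    omega
  · have := h.disjXZ i (by omega) (j + 1) (by omega) e.symm
    omega

lemma not_adj_pred_succ (h : IsThetaOn G lx ly lz x y z) (hy : 2 ≤ ly) (hz : 2 ≤ lz) {i : ℕ}
    (h0 : 0 < i) (hi : i < lx) : ¬ G.Adj (x (i - 1)) (x (i + 1)) := by
  intro hw
  rcases (h.adj_iff _ _).1 hw with
    ⟨j, hj, ⟨e, e'⟩ | ⟨e, e'⟩⟩ | ⟨j, hj, ⟨e, e'⟩ | ⟨e, e'⟩⟩ | ⟨j, hj, ⟨e, e'⟩ | ⟨e, e'⟩⟩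
  · have := h.injX _ (by omega) _ (by omega) e
    have := h.injX _ (by omega) _ (by omega) e'
    omega
  · have := h.injX _ (by omega) _ (by omega) e
    have := h.injX _ (by omega) _ (by omega) e'
    omega
  · have := h.disjXY _ (by omega) _ (by omega) e.symm
    have := h.disjXY _ (by omega) _ (by omega) e'.symm
    omega
  · have := h.disjXY _ (by omega) _ (by omega) e.symm
    have := h.disjXY _ (by omega) _ (by omega) e'.symm
    omega
  · have := h.disjXZ _ (by omega) _ (by omega) e.symm
    have := h.disjXZ _ (by omega) _ (by omega) e'.symm
    omega
  · have := h.disjXZ _ (by omega) _ (by omega) e.symm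
    have := h.disjXZ _ (by omega) _ (by omega) e'.symm
    omega

/-- An inner vertex of a path lies in no triangle. -/
lemma not_triangle_inner (h : IsThetaOn G lx ly lz x y z) (hy : 2 ≤ ly) (hz : 2 ≤ lz) {i : ℕ}
    (h0 : 0 < i) (hi : i < lx) {v w : V} (h1 : G.Adj (x i) v) (h2 : G.Adj (x i) w) :
    ¬ G.Adj v w := by
  have hn := h.not_adj_pred_succ hy hz h0 hi
  rcases h.eq_or_eq_of_adj h0 hi h1 with rfl | rfl <;>
    rcases h.eq_or_eq_of_adj h0 hi h2 with rfl | rfl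
  · exact G.loopless.irrefl _
  · exact hn
  · exact fun h => hn h.symm
  · exact G.loopless.irrefl _

/-- Every vertex is a branch vertex or lies in no triangle. -/
lemma eq_branch_or_not_triangle (h : IsThetaOn G lx ly lz x y z) (hx : 2 ≤ lx) (hy : 2 ≤ ly)
    (hz : 2 ≤ lz) (u : V) :
    (u = x 0 ∨ u = x lx) ∨ ∀ v w, G.Adj u v → G.Adj u w → ¬ G.Adj v w := by
  have key : ∀ {lx ly lz : ℕ} {x y z : ℕ → V}, IsThetaOn G lx ly lz x y z → 2 ≤ ly → 2 ≤ lz →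
      (∃ i ≤ lx, x i = u) →
      (u = x 0 ∨ u = x lx) ∨ ∀ v w, G.Adj u v → G.Adj u w → ¬ G.Adj v w := by
    rintro lx ly lz x y z h hy hz ⟨i, hi, rfl⟩
    rcases Nat.eq_zero_or_pos i with rfl | h0
    · exact Or.inl (Or.inl rfl)
    rcases hi.eq_or_lt with rfl | hi
    · exact Or.inl (Or.inr rfl)
    · exact Or.inr fun v w => h.not_triangle_inner hy hz h0 hi
  rcases h.cover u with hu | hu | hu
  · exact key h hy hz hu
  · rw [h.startXY, h.endXY]
    exact key h.rotate hz hx hu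
  · rw [h.startXY, h.endXY, h.startYZ, h.endYZ]
    exact key h.rotate.rotate hx hy hu

/-- Theta graphs whose paths have length at least two are triangle-free. -/
lemma triangle_free (h : IsThetaOn G lx ly lz x y z) (hx : 2 ≤ lx) (hy : 2 ≤ ly) (hz : 2 ≤ lz)
    {u v w : V} (huv : G.Adj u v) (huw : G.Adj u w) (hvw : G.Adj v w) : False := by
  rcases h.eq_branch_or_not_triangle hx hy hz u with hu | hu
  · rcases h.eq_branch_or_not_triangle hx hy hz v with hv | hv
    · rcases h.eq_branch_or_not_triangle hx hy hz w with hw | hw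
      · have := huv.ne
        have := huw.ne
        have := hvw.ne
        grind
      · exact hw u v huw.symm hvw.symm huv
    · exact hv u w huv.symm hvw huw
  · exact hu v w huv huw hvw

end IsThetaOn

section NonCrossing

variable {V : Type*} [LinearOrder V] {G : SimpleGraph V}

/-- No two edges of `G` cross when drawn as arcs above the line on which the vertices lie. -/
def NonCrossing (G : SimpleGraph V) : Prop :=
  ∀ x u v y : V, x < u → u < v → v < y → G.Adj x v → G.Adj u y → False

lemma NonCrossing.separates_iff (hG : NonCrossing G) {p p' q q' : V} (hp : G.Adj p p')
    (hq : G.Adj q q') (h1 : p ≠ q) (h2 : p ≠ q') (h3 : p' ≠ q) (h4 : p' ≠ q') :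
    (p < q ↔ p' < q) ↔ (p < q' ↔ p' < q') := by
  have key : ∀ {p p' q q' : V}, G.Adj p p' → G.Adj q q' → p < p' → q < q' →
      p ≠ q → p ≠ q' → p' ≠ q → p' ≠ q' → ((p < q ↔ p' < q) ↔ (p < q' ↔ p' < q')) := by
    intro p p' q q' hp hq hpp hqq h1 h2 h3 h4
    have c1 := fun a b c => hG p q p' q' a b c hp hq
    have c2 := fun a b c => hG q p q' p' a b c hq hp
    have := h1.lt_or_gt
    have := h2.lt_or_gt
    have := h3.lt_or_gt
    have := h4.lt_or_gt
    grind
  rcases hp.ne.lt_or_gt with a | a <;> rcases hq.ne.lt_or_gt with b | b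
  · exact key hp hq a b h1 h2 h3 h4
  · have := key hp hq.symm a b h2 h1 h4 h3
    tauto
  · have := key hp.symm hq a b h3 h4 h1 h2
    tauto
  · have := key hp.symm hq.symm a b h4 h3 h2 h1
    tauto

/-- Disjoint paths in a non-crossing graph: the ends of one do not separate the ends of the
other. -/
lemma NonCrossing.paths_separate_iff (hG : NonCrossing G) {P Q : ℕ → V} {i i' j j' : ℕ}
    (hi : i ≤ i') (hj : j ≤ j') (hP : ∀ k, i ≤ k → k < i' → G.Adj (P k) (P (k + 1)))
    (hQ : ∀ k, j ≤ k → k < j' → G.Adj (Q k) (Q (k + 1)))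
    (hPQ : ∀ k, i ≤ k → k ≤ i' → ∀ l, j ≤ l → l ≤ j' → P k ≠ Q l) :
    (P i < Q j ↔ P i' < Q j) ↔ (P i < Q j' ↔ P i' < Q j') := by
  have step : ∀ l, j ≤ l → l < j' →
      ((P i < Q l ↔ P i' < Q l) ↔ (P i < Q (l + 1) ↔ P i' < Q (l + 1))) := by
    intro l hl hl'
    induction i', hi using Nat.le_induction with
    | base => simp
    | succ k hk ih =>
      have h1 := ih (fun m h h' => hP m h (by omega)) (fun m h h' => hPQ m h (by omega))
      have h2 := hG.separates_iff (hP k hk (by omega)) (hQ l hl hl')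
        (hPQ k hk (by omega) l hl (by omega)) (hPQ k hk (by omega) (l + 1) (by omega) (by omega))
        (hPQ (k + 1) (by omega) le_rfl l hl (by omega))
        (hPQ (k + 1) (by omega) le_rfl (l + 1) (by omega) (by omega))
      clear * - h1 h2
      grind
  clear hQ hPQ
  induction j', hj using Nat.le_induction with
  | base => rfl
  | succ k hk ih =>
    have h1 := ih (fun m h h' => step m h (by omega))
    exact h1.trans (step k hk (by omega))

namespace IsThetaOn

variable {lx ly lz : ℕ} {x y z : ℕ → V}

/-- The inner vertices of a path lie all between or all not between the branch vertices. -/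
lemma same_side (h : IsThetaOn G lx ly lz x y z) (hG : NonCrossing G) (hx : 2 ≤ lx) :
    (y 0 < x 1 ↔ y ly < x 1) ↔ (y 0 < x (lx - 1) ↔ y ly < x (lx - 1)) := by
  refine hG.paths_separate_iff (by omega) (by omega) (fun k _ hk => h.swap.adjX hk)
    (fun k _ hk => h.adjX (by omega)) fun k _ hk l hl hl' e => ?_
  have := h.disjXY l (by omega) k hk e.symm
  omega

/-- An initial segment and a disjoint final segment of one path. -/
lemma initial_final (h : IsThetaOn G lx ly lz x y z) (hG : NonCrossing G) (hx : 3 ≤ lx) :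
    (x 0 < x (lx - 1) ↔ x 1 < x (lx - 1)) ↔ (x 0 < x lx ↔ x 1 < x lx) := by
  refine hG.paths_separate_iff (by omega) (by omega) (fun k _ hk => h.adjX (by omega))
    (fun k _ hk => h.adjX (by omega)) fun k _ hk l hl hl' e => ?_
  have := h.injX k (by omega) l (by omega) e
  omega

/-- A path without its last vertex and another one without its first vertex. -/
lemma initial_final_of_two (h : IsThetaOn G lx ly lz x y z) (hG : NonCrossing G) (hx : 2 ≤ lx)
    (hy : 2 ≤ ly) : (x 0 < y 1 ↔ x (lx - 1) < y 1) ↔ (x 0 < y ly ↔ x (lx - 1) < y ly) := by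
  refine hG.paths_separate_iff (by omega) (by omega) (fun k _ hk => h.adjX (by omega))
    (fun k _ hk => h.swap.adjX (by omega)) fun k _ hk l hl hl' e => ?_
  have := h.disjXY k (by omega) l (by omega) e
  omega

/-- Two paths cannot lie on the same side of the branch vertices. -/
lemma not_same_side (h : IsThetaOn G lx ly lz x y z) (hG : NonCrossing G) (hx : 2 ≤ lx)
    (hy : 2 ≤ ly) : ¬ ((x 0 < x 1 ↔ x lx < x 1) ↔ (x 0 < y 1 ↔ x lx < y 1)) := by
  intro hs
  have s1 := h.same_side hG hx
  have s2 := h.swap.same_side hG hy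
  have m1 := h.initial_final_of_two hG hx hy
  have m2 := h.swap.initial_final_of_two hG hy hx
  have f1 : x 1 = x (lx - 1) ∨
      ((x 0 < x (lx - 1) ↔ x 1 < x (lx - 1)) ↔ (x 0 < x lx ↔ x 1 < x lx)) := by
    rcases hx.eq_or_lt with rfl | hx
    · exact Or.inl rfl
    · exact Or.inr (h.initial_final hG hx)
  have f2 : y 1 = y (ly - 1) ∨
      ((y 0 < y (ly - 1) ↔ y 1 < y (ly - 1)) ↔ (y 0 < y ly ↔ y 1 < y ly)) := by
    rcases hy.eq_or_lt with rfl | hy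
    · exact Or.inl rfl
    · exact Or.inr (h.swap.initial_final hG hy)
  have n1 : x 1 ≠ x 0 := fun e => by have := h.injX _ (by omega) _ (by omega) e; omega
  have n2 : x 1 ≠ x lx := fun e => by have := h.injX _ (by omega) _ (by omega) e; omega
  have n3 : x (lx - 1) ≠ x 0 := fun e => by have := h.injX _ (by omega) _ (by omega) e; omega
  have n4 : x (lx - 1) ≠ x lx := fun e => by have := h.injX _ (by omega) _ (by omega) e; omega
  have n5 : y 1 ≠ y 0 := fun e => by have := h.injY _ (by omega) _ (by omega) e; omega
  have n6 : y 1 ≠ y ly := fun e => by have := h.injY _ (by omega) _ (by omega) e; omega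
  have n7 : y (ly - 1) ≠ y 0 := fun e => by have := h.injY _ (by omega) _ (by omega) e; omega
  have n8 : y (ly - 1) ≠ y ly := fun e => by have := h.injY _ (by omega) _ (by omega) e; omega
  have n9 : x 0 ≠ x lx := fun e => by have := h.injX _ (by omega) _ (by omega) e; omega
  have d1 : x 1 ≠ y 1 := fun e => by have := h.disjXY _ (by omega) _ (by omega) e; omega
  have d2 : x (lx - 1) ≠ y 1 := fun e => by have := h.disjXY _ (by omega) _ (by omega) e; omega
  have d3 : x 1 ≠ y (ly - 1) := fun e => by have := h.disjXY _ (by omega) _ (by omega) e; omega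
  rw [h.startXY, h.endXY] at *
  generalize x 1 = α, x (lx - 1) = α', y 1 = β, y (ly - 1) = β', y 0 = a, y ly = b at *
  clear h
  simp only [← lt_or_lt_iff_ne] at n1 n2 n3 n4 n5 n6 n7 n8 n9 d1 d2 d3
  grind

/-- Theta graphs have no non-crossing linear layout. -/
lemma not_nonCrossing (h : IsThetaOn G lx ly lz x y z) (hx : 2 ≤ lx) (hy : 2 ≤ ly)
    (hz : 2 ≤ lz) : ¬ NonCrossing G := by
  intro hG
  have h1 := h.not_same_side hG hx hy
  have h2 := h.rotate.not_same_side hG hy hz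
  have h3 := h.rotate.rotate.not_same_side hG hz hx
  rw [h.startXY, h.endXY] at h1
  rw [← h.startYZ, ← h.endYZ] at h3
  tauto

end IsThetaOn

end NonCrossing

/-- Two crossing edges in a central realization produce a triangle. -/
lemma IsCAND1Real.triangle_of_crossing {V : Type*} {G : SimpleGraph V} {L R p : V → ℝ}
    (h : IsCAND1Real G L R p) {x u v y : V} (hxu : x ≠ u) (huv : u ≠ v) (hvy : v ≠ y)
    (h1 : p x ≤ p u) (h2 : p u ≤ p v) (h3 : p v ≤ p y) (hxv : G.Adj x v) (huy : G.Adj u y) :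
    G.Adj u v ∧ (G.Adj x u ∨ G.Adj v y) := by
  obtain ⟨⟨-, had⟩, hc⟩ := h
  have e1 := (had _ _ hxv.ne).1 hxv
  have e2 := (had _ _ huy.ne).1 huy
  have := hc x
  have := hc u
  have := hc v
  have := hc y
  refine ⟨(had _ _ huv).2 (by refine ⟨?_, ?_, ?_, ?_⟩ <;> linarith), ?_⟩
  rcases le_total (p v - p u) ((p u - p x) - (p y - p v)) with hle | hle
  · right
    refine (had _ _ hvy).2 ⟨?_, ?_, ?_, ?_⟩ <;> linarith
  · left
    refine (had _ _ hxu).2 ⟨?_, ?_, ?_, ?_⟩ <;> linarith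

/-- A triangle-free graph in `c-AND(1)` has a non-crossing linear layout. -/
lemma InCAND1.exists_nonCrossing {V : Type*} {G : SimpleGraph V} (h : InCAND1 G)
    (ht : ∀ u v w, G.Adj u v → G.Adj u w → G.Adj v w → False) :
    ∃ _ : LinearOrder V, NonCrossing G := by
  obtain ⟨L, R, p, h⟩ := h
  classical
  let : LinearOrder V := linearOrderOfSTO WellOrderingRel
  let f : V → ℝ ×ₗ V := fun v => toLex (p v, v)
  have hf : Function.Injective f := fun u v e => by
    have := congrArg (fun t => (ofLex t).2) e
    simpa [f] using this
  have hmono : ∀ u v, f u < f v → u ≠ v ∧ p u ≤ p v := by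
    intro u v huv
    refine ⟨fun e => by simp [e] at huv, ?_⟩
    rcases Prod.Lex.toLex_lt_toLex.1 huv with h | h
    · exact h.le
    · exact h.1.le
  refine ⟨LinearOrder.lift' f hf, fun x u v y h1 h2 h3 hxv huy => ?_⟩
  obtain ⟨n1, h1⟩ := hmono x u h1
  obtain ⟨n2, h2⟩ := hmono u v h2
  obtain ⟨n3, h3⟩ := hmono v y h3
  obtain ⟨huv, hxu | hvy⟩ := h.triangle_of_crossing n1 n2 n3 h1 h2 h3 hxv huy
  · exact ht x u v hxu hxv huv
  · exact ht u v y huv huy hvy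

/-- Theta graphs are not in `c-AND(1)`. -/
lemma IsThetaGraph.not_inCAND1 {V : Type*} {G : SimpleGraph V} {lx ly lz : ℕ}
    (h : IsThetaGraph G lx ly lz) (hx : 2 ≤ lx) (hy : 2 ≤ ly) (hz : 2 ≤ lz) : ¬ InCAND1 G := by
  intro hc
  obtain ⟨x, y, z, h⟩ := h.exists_isThetaOn
  obtain ⟨_, hG⟩ := hc.exists_nonCrossing fun u v w => h.triangle_free hx hy hz
  exact h.not_nonCrossing hx hy hz hG

/-- A finite graph with a vertex ordering satisfying the four point condition is in `AND(1)`. -/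
lemma FourPointCond.inAND1 {V : Type*} [Finite V] {G : SimpleGraph V} {f : V → ℝ}
    (h : FourPointCond G f) : InAND1 G := by
  obtain ⟨hinj, h4⟩ := h
  let S : V → Set ℝ := fun v => f '' {w | w = v ∨ G.Adj v w}
  have hfin : ∀ v, (S v).Finite := fun v => Set.toFinite _
  have hself : ∀ v, f v ∈ S v := fun v => ⟨v, Or.inl rfl, rfl⟩
  have hle : ∀ v, ∀ t ∈ S v, sInf (S v) ≤ t ∧ t ≤ sSup (S v) := fun v t ht =>
    ⟨csInf_le (hfin v).bddBelow ht, le_csSup (hfin v).bddAbove ht⟩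
  refine ⟨fun v => sInf (S v), fun v => sSup (S v), f, fun v => hle v _ (hself v), ?_⟩
  have key : ∀ u v, f u < f v → f v ≤ sSup (S u) → sInf (S v) ≤ f u → G.Adj u v := by
    intro u v huv hu hv
    obtain ⟨y, hy, ey⟩ := Set.Nonempty.csSup_mem ⟨_, hself u⟩ (hfin u)
    obtain ⟨x, hx, ex⟩ := Set.Nonempty.csInf_mem ⟨_, hself v⟩ (hfin v)
    rw [← ey] at hu
    rw [← ex] at hv
    have hy : G.Adj u y := hy.resolve_left (by rintro rfl; linarith)
    have hx : G.Adj v x := hx.resolve_left (by rintro rfl; linarith)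
    rcases hu.eq_or_lt with e | hu
    · rwa [hinj e]
    rcases hv.eq_or_lt with e | hv
    · exact hinj e ▸ hx.symm
    exact h4 x u v y hv huv hu hx.symm hy
  refine fun u v huv => ⟨fun ha => ?_, fun ⟨h1, h2, h3, h4⟩ => ?_⟩
  · have hu := hle u (f v) ⟨v, Or.inr ha, rfl⟩
    have hv := hle v (f u) ⟨u, Or.inr ha.symm, rfl⟩
    exact ⟨hu.1, hu.2, hv.1, hv.2⟩
  · rcases (hinj.ne huv).lt_or_gt with hlt | hlt
    · exact key u v hlt h2 h3
    · exact (key v u hlt h4 h1).symm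

namespace IsThetaOn

variable {V : Type*} {G : SimpleGraph V} {lx ly lz : ℕ} {x y z : ℕ → V}

lemma finite (h : IsThetaOn G lx ly lz x y z) : Finite V := by
  have : (Set.univ : Set V) ⊆ x '' Set.Iic lx ∪ (y '' Set.Iic ly ∪ z '' Set.Iic lz) :=
    fun v _ => h.cover v
  refine Set.finite_univ_iff.1 (Set.Finite.subset ?_ this)
  exact ((Set.finite_Iic _).image _).union
    (((Set.finite_Iic _).image _).union ((Set.finite_Iic _).image _))

/-- Functions on the three paths which agree at the branch vertices glue. -/
lemma exists_glue (h : IsThetaOn G lx ly lz x y z) (fx fy fz : ℕ → ℕ) (h1 : fx 0 = fy 0)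
    (h2 : fy 0 = fz 0) (h3 : fx lx = fy ly) (h4 : fy ly = fz lz) :
    ∃ f : V → ℕ, (∀ i ≤ lx, f (x i) = fx i) ∧ (∀ i ≤ ly, f (y i) = fy i) ∧
      ∀ i ≤ lz, f (z i) = fz i := by
  have : ∀ v, ∃ n, (∀ i ≤ lx, x i = v → n = fx i) ∧ (∀ i ≤ ly, y i = v → n = fy i) ∧
      ∀ i ≤ lz, z i = v → n = fz i := by
    intro v
    rcases h.cover v with ⟨i, hi, rfl⟩ | ⟨i, hi, rfl⟩ | ⟨i, hi, rfl⟩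
    · refine ⟨fx i, fun j hj e => ?_, fun j hj e => ?_, fun j hj e => ?_⟩
      · rw [h.injX j hj i hi e]
      · rcases h.disjXY i hi j hj e.symm with ⟨rfl, rfl⟩ | ⟨rfl, rfl⟩ <;> assumption
      · rcases h.disjXZ i hi j hj e.symm with ⟨rfl, rfl⟩ | ⟨rfl, rfl⟩ <;> omega
    · refine ⟨fy i, fun j hj e => ?_, fun j hj e => ?_, fun j hj e => ?_⟩
      · rcases h.disjXY j hj i hi e with ⟨rfl, rfl⟩ | ⟨rfl, rfl⟩ <;> omega
      · rw [h.injY j hj i hi e]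
      · rcases h.disjYZ i hi j hj e.symm with ⟨rfl, rfl⟩ | ⟨rfl, rfl⟩ <;> assumption
    · refine ⟨fz i, fun j hj e => ?_, fun j hj e => ?_, fun j hj e => ?_⟩
      · rcases h.disjXZ j hj i hi e with ⟨rfl, rfl⟩ | ⟨rfl, rfl⟩ <;> omega
      · rcases h.disjYZ j hj i hi e with ⟨rfl, rfl⟩ | ⟨rfl, rfl⟩ <;> omega
      · rw [h.injZ j hj i hi e]
  choose f hf using this
  exact ⟨f, fun i hi => (hf _).1 i hi rfl, fun i hi => (hf _).2.1 i hi rfl,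
    fun i hi => (hf _).2.2 i hi rfl⟩

/-- A function is injective when it is so along each path and separates the paths off the branch
vertices. -/
lemma injective_of_paths (h : IsThetaOn G lx ly lz x y z) {f : V → ℕ} {fx fy fz : ℕ → ℕ}
    (hx : ∀ i ≤ lx, f (x i) = fx i) (hy : ∀ i ≤ ly, f (y i) = fy i)
    (hz : ∀ i ≤ lz, f (z i) = fz i)
    (ix : ∀ i ≤ lx, ∀ j ≤ lx, fx i = fx j → i = j) (iy : ∀ i ≤ ly, ∀ j ≤ ly, fy i = fy j → i = j)
    (iz : ∀ i ≤ lz, ∀ j ≤ lz, fz i = fz j → i = j)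
    (dxy : ∀ i ≤ lx, ∀ j ≤ ly, fx i = fy j → (i = 0 ∧ j = 0) ∨ (i = lx ∧ j = ly))
    (dxz : ∀ i ≤ lx, ∀ j ≤ lz, fx i = fz j → (i = 0 ∧ j = 0) ∨ (i = lx ∧ j = lz))
    (dyz : ∀ i ≤ ly, ∀ j ≤ lz, fy i = fz j → (i = 0 ∧ j = 0) ∨ (i = ly ∧ j = lz)) :
    Function.Injective f := by
  intro u v e
  rcases h.cover u with ⟨i, hi, rfl⟩ | ⟨i, hi, rfl⟩ | ⟨i, hi, rfl⟩ <;>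
    rcases h.cover v with ⟨j, hj, rfl⟩ | ⟨j, hj, rfl⟩ | ⟨j, hj, rfl⟩ <;>
    simp only [hx, hy, hz, hi, hj] at e
  · rw [ix i hi j hj e]
  · rcases dxy i hi j hj e with ⟨rfl, rfl⟩ | ⟨rfl, rfl⟩ <;>
      simp only [h.startXY, h.startYZ, h.endXY, h.endYZ]
  · rcases dxz i hi j hj e with ⟨rfl, rfl⟩ | ⟨rfl, rfl⟩ <;>
      simp only [h.startXY, h.startYZ, h.endXY, h.endYZ]
  · rcases dxy j hj i hi e.symm with ⟨rfl, rfl⟩ | ⟨rfl, rfl⟩ <;>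
      simp only [h.startXY, h.startYZ, h.endXY, h.endYZ]
  · rw [iy i hi j hj e]
  · rcases dyz i hi j hj e with ⟨rfl, rfl⟩ | ⟨rfl, rfl⟩ <;> simp only [h.startYZ, h.endYZ]
  · rcases dxz j hj i hi e.symm with ⟨rfl, rfl⟩ | ⟨rfl, rfl⟩ <;>
      simp only [h.startXY, h.startYZ, h.endXY, h.endYZ]
  · rcases dyz j hj i hi e.symm with ⟨rfl, rfl⟩ | ⟨rfl, rfl⟩ <;> simp only [h.startYZ, h.endYZ]
  · rw [iz i hi j hj e]

/-- The relation between the positions of the ends of an edge can be checked along the paths. -/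
lemma adj_positions (h : IsThetaOn G lx ly lz x y z) {f : V → ℕ} {fx fy fz : ℕ → ℕ}
    (hx : ∀ i ≤ lx, f (x i) = fx i) (hy : ∀ i ≤ ly, f (y i) = fy i)
    (hz : ∀ i ≤ lz, f (z i) = fz i) {r : ℕ → ℕ → Prop}
    (rx : ∀ i < lx, r (fx i) (fx (i + 1)) ∧ r (fx (i + 1)) (fx i))
    (ry : ∀ i < ly, r (fy i) (fy (i + 1)) ∧ r (fy (i + 1)) (fy i))
    (rz : ∀ i < lz, r (fz i) (fz (i + 1)) ∧ r (fz (i + 1)) (fz i)) {u v : V} (huv : G.Adj u v) :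
    r (f u) (f v) := by
  rcases (h.adj_iff _ _).1 huv with
    ⟨j, hj, ⟨rfl, rfl⟩ | ⟨rfl, rfl⟩⟩ | ⟨j, hj, ⟨rfl, rfl⟩ | ⟨rfl, rfl⟩⟩ |
    ⟨j, hj, ⟨rfl, rfl⟩ | ⟨rfl, rfl⟩⟩
  · rw [hx _ hj.le, hx _ hj]; exact (rx j hj).1
  · rw [hx _ hj.le, hx _ hj]; exact (rx j hj).2
  · rw [hy _ hj.le, hy _ hj]; exact (ry j hj).1
  · rw [hy _ hj.le, hy _ hj]; exact (ry j hj).2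
  · rw [hz _ hj.le, hz _ hj]; exact (rz j hj).1
  · rw [hz _ hj.le, hz _ hj]; exact (rz j hj).2

/-- The vertices in the order `a, y₁, …, b, x₁, z_{lz-1}, …, z₁`. -/
lemma inAND1_two (h : IsThetaOn G 2 ly lz x y z) (hly : 2 ≤ ly) (hlz : 2 ≤ lz) : InAND1 G := by
  have := h.finite
  let fx : ℕ → ℕ := fun i => if i = 0 then 0 else if i = 1 then ly + 1 else ly
  let fz : ℕ → ℕ := fun i => if i = 0 then 0 else if i = lz then ly else ly + 1 + lz - i
  obtain ⟨f, hx, hy, hz⟩ := h.exists_glue fx id fz (by grind) (by grind) (by grind) (by grind)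
  have hinj : Function.Injective f := h.injective_of_paths hx hy hz
    (by grind) (by grind) (by grind) (by grind) (by grind) (by grind)
  have hadj : ∀ {u v}, G.Adj u v → f u < f v → f v = f u + 1 ∨ (f u = 0 ∧ f v = ly + lz) ∨
      (f u = 0 ∧ f v = ly + 1) ∨ (f u = ly ∧ f v = ly + 2) :=
    h.adj_positions hx hy hz (r := fun s t => s < t → t = s + 1 ∨ (s = 0 ∧ t = ly + lz) ∨
      (s = 0 ∧ t = ly + 1) ∨ (s = ly ∧ t = ly + 2)) (by grind) (by grind) (by grind)
  refine FourPointCond.inAND1 (f := fun v => (f v : ℝ))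
    ⟨Nat.cast_injective.comp hinj, fun p u v q h1 h2 h3 hpv huq => ?_⟩
  rw [Nat.cast_lt] at h1 h2 h3
  have e1 := hadj hpv (by omega)
  have e2 := hadj huq (by omega)
  have hb : f (x 2) = ly := by grind
  have hm : f (x 1) = ly + 1 := by grind
  have hu : f u = f (x 2) := by omega
  have hv : f v = f (x 1) := by omega
  rw [hinj hu, hinj hv]
  exact (h.adjX (by omega)).symm

/-- The vertices in the order `z₁, x₁, a, y₁, …, b, x₂, z_{lz-1}, …, z₂`. -/
lemma inAND1_three (h : IsThetaOn G 3 ly lz x y z) (hly : 2 ≤ ly) (hlz : 3 ≤ lz) : InAND1 G := by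
  have := h.finite
  let fx : ℕ → ℕ := fun i =>
    if i = 0 then 2 else if i = 1 then 1 else if i = 2 then ly + 3 else ly + 2
  let fz : ℕ → ℕ := fun i =>
    if i = 0 then 2 else if i = 1 then 0 else if i = lz then ly + 2 else ly + 3 + lz - i
  obtain ⟨f, hx, hy, hz⟩ := h.exists_glue fx (· + 2) fz (by grind) (by grind) (by grind) (by grind)
  have hinj : Function.Injective f := h.injective_of_paths hx hy hz
    (by grind) (by grind) (by grind) (by grind) (by grind) (by grind)
  have hadj : ∀ {u v}, G.Adj u v → f u < f v → f v = f u + 1 ∨ (f u = 0 ∧ f v = ly + lz + 1) ∨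
      (f u = 0 ∧ f v = 2) ∨ (f u = 1 ∧ f v = ly + 3) ∨ (f u = ly + 2 ∧ f v = ly + 4) :=
    h.adj_positions hx hy hz (r := fun s t => s < t → t = s + 1 ∨ (s = 0 ∧ t = ly + lz + 1) ∨
      (s = 0 ∧ t = 2) ∨ (s = 1 ∧ t = ly + 3) ∨ (s = ly + 2 ∧ t = ly + 4))
      (by grind) (by grind) (by grind)
  refine FourPointCond.inAND1 (f := fun v => (f v : ℝ))
    ⟨Nat.cast_injective.comp hinj, fun p u v q h1 h2 h3 hpv huq => ?_⟩
  rw [Nat.cast_lt] at h1 h2 h3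
  have e1 := hadj hpv (by omega)
  have e2 := hadj huq (by omega)
  have h0 : f (x 0) = 2 := by grind
  have h1' : f (x 1) = 1 := by grind
  have h2' : f (x 2) = ly + 3 := by grind
  have h3' : f (x 3) = ly + 2 := by grind
  have hcases : (f u = f (x 1) ∧ f v = f (x 0)) ∨ (f u = f (x 3) ∧ f v = f (x 2)) := by omega
  rcases hcases with ⟨hu, hv⟩ | ⟨hu, hv⟩ <;> rw [hinj hu, hinj hv]
  · exact (h.adjX (by omega)).symm
  · exact (h.adjX (by omega)).symm

end IsThetaOn

/-- `K_{2,3}` is the theta graph `H^{2,2,2}`. -/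
lemma isThetaGraph_completeBipartiteGraph :
    IsThetaGraph (completeBipartiteGraph (Fin 2) (Fin 3)) 2 2 2 := by
  refine ⟨![Sum.inl 0, Sum.inr 0, Sum.inl 1], ![Sum.inl 0, Sum.inr 1, Sum.inl 1],
    ![Sum.inl 0, Sum.inr 2, Sum.inl 1], by decide, by decide, by decide, rfl, rfl, rfl, rfl,
    by decide, by decide, by decide, by decide, ?_⟩
  simp only [completeBipartiteGraph_adj]
  decide

/-- For all path lengths `3 ≤ lx ≤ ly ≤ lz` the theta graph `H^{lx, ly, lz}`
does not belong to `c-AND(1)`; moreover `H^{2, ly, lz}` (for `ly, lz ≥ 2`) and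
`H^{3, ly, lz}` (for `ly, lz ≥ 3`) belong to `AND(1)`.  In particular
`K_{2,3} = H^{2,2,2}` belongs to `AND(1)` but not to `c-AND(1)`. -/
theorem theta_cand1_and1_separation :
    (∀ {V : Type*} (G : SimpleGraph V) (lx ly lz : ℕ),
      3 ≤ lx → lx ≤ ly → ly ≤ lz → IsThetaGraph G lx ly lz → ¬ InCAND1 G) ∧
    (∀ {V : Type*} (G : SimpleGraph V) (ly lz : ℕ),
      2 ≤ ly → 2 ≤ lz → IsThetaGraph G 2 ly lz → InAND1 G) ∧
    (∀ {V : Type*} (G : SimpleGraph V) (ly lz : ℕ),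
      3 ≤ ly → 3 ≤ lz → IsThetaGraph G 3 ly lz → InAND1 G) ∧
    InAND1 (completeBipartiteGraph (Fin 2) (Fin 3)) ∧
    ¬ InCAND1 (completeBipartiteGraph (Fin 2) (Fin 3)) := by
  exact ⟨fun G lx ly lz hx hxy hyz h => h.not_inCAND1 (by omega) (by omega) (by omega),
    fun G ly lz hy hz h => by
      obtain ⟨x, y, z, h⟩ := h.exists_isThetaOn
      exact h.inAND1_two hy hz,
    fun G ly lz hy hz h => by
      obtain ⟨x, y, z, h⟩ := h.exists_isThetaOn
      exact h.inAND1_three (by omega) hz,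
    by
      obtain ⟨x, y, z, h⟩ := isThetaGraph_completeBipartiteGraph.exists_isThetaOn
      exact h.inAND1_two le_rfl le_rfl,
    isThetaGraph_completeBipartiteGraph.not_inCAND1 le_rfl le_rfl le_rfl⟩
end
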